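/- The generating set consisting of the nine functions tr(X₁), tr(X₂), tr(X₁X₂), tr(X₁⁻¹), tr(X₂⁻¹), tr(X₁X₂⁻¹), tr(X₂X₁⁻¹), tr(X₁⁻¹X₂⁻¹), tr(X₁X₂X₁⁻¹X₂⁻¹) on SL(3,ℂ) × SL(3,ℂ) is minimal: none of these nine functions lies in the ℂ-subalgebra of functions SL(3,ℂ)² → ℂ generated by the other eight. -/

import Mathlib

/-- `SL(3,ℂ)`. -/
abbrev SL3 := Matrix.SpecialLinearGroup (Fin 3) ℂ

/-- Trace of an element of `SL(3,ℂ)`, as the trace of the underlying matrix. -/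
noncomputable def tr3 (X : SL3) : ℂ := Matrix.trace (X : Matrix (Fin 3) (Fin 3) ℂ)

/-- The nine generators tr X₁, tr X₂, tr X₁X₂, tr X₁⁻¹, tr X₂⁻¹, tr X₁X₂⁻¹,
tr X₂X₁⁻¹, tr X₁⁻¹X₂⁻¹, tr X₁X₂X₁⁻¹X₂⁻¹ on SL(3,ℂ) × SL(3,ℂ). -/
noncomputable def nineGens : Fin 9 → (SL3 × SL3 → ℂ) :=
  ![fun X => tr3 X.1,
    fun X => tr3 X.2,
    fun X => tr3 (X.1 * X.2),
    fun X => tr3 X.1⁻¹,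
    fun X => tr3 X.2⁻¹,
    fun X => tr3 (X.1 * X.2⁻¹),
    fun X => tr3 (X.2 * X.1⁻¹),
    fun X => tr3 (X.1⁻¹ * X.2⁻¹),
    fun X => tr3 (X.1 * X.2 * X.1⁻¹ * X.2⁻¹)]

/-- An element of the adjoin of the other generators cannot separate two points which the other
generators do not separate. -/
theorem not_mem_of_points (i : Fin 9) (p q : SL3 × SL3)
    (h : ∀ j, j ≠ i → nineGens j p = nineGens j q) (hi : nineGens i p ≠ nineGens i q) :
    nineGens i ∉ Algebra.adjoin ℂ (nineGens '' {j | j ≠ i}) := by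
  intro hm
  apply hi
  generalize nineGens i = f at hm
  induction hm using Algebra.adjoin_induction with
  | mem x hx =>
    obtain ⟨j, hj, rfl⟩ := hx
    exact h j hj
  | algebraMap r => rfl
  | add x y _ _ hx hy => simp [hx, hy]
  | mul x y _ _ hx hy => simp [hx, hy]

/-- The scalar matrix `w` with `w ^ 3 = 1`. -/
noncomputable def sc (w : ℂ) (h : w ^ 3 = 1) : SL3 :=
  ⟨!![w, 0, 0; 0, w, 0; 0, 0, w], by
    simp [Matrix.det_fin_three]; linear_combination h⟩

/-- Diagonal matrices. -/
noncomputable def dg (a b c : ℂ) (h : a * b * c = 1) : SL3 :=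
  ⟨!![a, 0, 0; 0, b, 0; 0, 0, c], by
    simp [Matrix.det_fin_three]; linear_combination h⟩

/-- The cyclic permutation matrix. -/
noncomputable def cyc : SL3 :=
  ⟨!![0, 1, 0; 0, 0, 1; 1, 0, 0], by simp [Matrix.det_fin_three]⟩

theorem dg_inv (a b c : ℂ) (h : a * b * c = 1) :
    (dg a b c h)⁻¹ = dg (b * c) (a * c) (a * b) (by linear_combination (a * b * c + 1) * h) := by
  apply Subtype.ext
  rw [Matrix.SpecialLinearGroup.coe_inv]
  simp [dg, Matrix.adjugate_fin_three]

theorem sc_inv (w : ℂ) (h : w ^ 3 = 1) :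
    (sc w h)⁻¹ = sc (w ^ 2) (by linear_combination (w ^ 3 + 1) * h) := by
  apply Subtype.ext
  rw [Matrix.SpecialLinearGroup.coe_inv]
  simp [sc, Matrix.adjugate_fin_three, pow_two]

theorem sc_comm (w : ℂ) (h : w ^ 3 = 1) (X : SL3) : X * sc w h = sc w h * X := by
  apply Subtype.ext
  rw [Matrix.SpecialLinearGroup.coe_mul, Matrix.SpecialLinearGroup.coe_mul]
  ext i j
  fin_cases i <;> fin_cases j <;>
    simp [sc, Matrix.mul_apply, Fin.sum_univ_three, mul_comm]

theorem tr3_sc_mul (w : ℂ) (h : w ^ 3 = 1) (X : SL3) : tr3 (sc w h * X) = w * tr3 X := by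
  rw [tr3, tr3, Matrix.SpecialLinearGroup.coe_mul]
  simp only [Matrix.trace_fin_three, Matrix.mul_apply, Fin.sum_univ_three]
  simp [sc]
  ring

theorem tr3_comm (X Y : SL3) : tr3 (X * Y) = tr3 (Y * X) := by
  rw [tr3, tr3, Matrix.SpecialLinearGroup.coe_mul, Matrix.SpecialLinearGroup.coe_mul,
    Matrix.trace_mul_comm]

theorem tr3_dg (a b c : ℂ) (h : a * b * c = 1) : tr3 (dg a b c h) = a + b + c := by
  simp [tr3, dg, Matrix.trace_fin_three]

/-- The inverse of the cyclic permutation matrix. -/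
noncomputable def cyc' : SL3 :=
  ⟨!![0, 0, 1; 1, 0, 0; 0, 1, 0], by simp [Matrix.det_fin_three]⟩

theorem cyc_inv : cyc⁻¹ = cyc' := by
  apply Subtype.ext
  rw [Matrix.SpecialLinearGroup.coe_inv]
  simp [cyc, cyc', Matrix.adjugate_fin_three]

theorem cyc'_inv : cyc'⁻¹ = cyc := by rw [← cyc_inv, inv_inv]

theorem tr3_cyc : tr3 cyc = 0 := by
  simp [tr3, cyc, Matrix.trace_fin_three]

theorem tr3_cyc' : tr3 cyc' = 0 := by
  simp [tr3, cyc', Matrix.trace_fin_three]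

theorem tr3_dg_cyc (a b c : ℂ) (h : a * b * c = 1) : tr3 (dg a b c h * cyc) = 0 := by
  rw [tr3, Matrix.SpecialLinearGroup.coe_mul]
  simp [dg, cyc, Matrix.trace_fin_three, Matrix.mul_apply, Fin.sum_univ_three]

theorem tr3_dg_cyc' (a b c : ℂ) (h : a * b * c = 1) : tr3 (dg a b c h * cyc') = 0 := by
  rw [tr3, Matrix.SpecialLinearGroup.coe_mul]
  simp [dg, cyc', Matrix.trace_fin_three, Matrix.mul_apply, Fin.sum_univ_three]

theorem tr3_cyc_dg (a b c : ℂ) (h : a * b * c = 1) : tr3 (cyc * dg a b c h) = 0 := by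
  rw [tr3_comm, tr3_dg_cyc]

theorem tr3_cyc'_dg (a b c : ℂ) (h : a * b * c = 1) : tr3 (cyc' * dg a b c h) = 0 := by
  rw [tr3_comm, tr3_dg_cyc']

theorem cyc_mul_dg (a b c : ℂ) (h : a * b * c = 1) :
    cyc * dg a b c h = dg b c a (by linear_combination h) * cyc := by
  apply Subtype.ext
  rw [Matrix.SpecialLinearGroup.coe_mul, Matrix.SpecialLinearGroup.coe_mul]
  ext i j
  fin_cases i <;> fin_cases j <;>
    simp [dg, cyc, Matrix.mul_apply, Fin.sum_univ_three]

theorem dg_mul_dg (a b c : ℂ) (h : a * b * c = 1) (a' b' c' : ℂ) (h' : a' * b' * c' = 1) :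
    dg a b c h * dg a' b' c' h' = dg (a * a') (b * b') (c * c')
      (by linear_combination (a' * b' * c') * h + h') := by
  apply Subtype.ext
  rw [Matrix.SpecialLinearGroup.coe_mul]
  ext i j
  fin_cases i <;> fin_cases j <;>
    simp [dg, Matrix.mul_apply, Fin.sum_univ_three]

/-- Values of the generators after rescaling by central elements. -/
theorem gens_scale (w u : ℂ) (hw : w ^ 3 = 1) (hu : u ^ 3 = 1) (X Y : SL3) (j : Fin 9) :
    nineGens j (sc w hw * X, sc u hu * Y) =
      (![w, u, w * u, w ^ 2, u ^ 2, w * u ^ 2, u * w ^ 2, w ^ 2 * u ^ 2, 1] : Fin 9 → ℂ) j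
        * nineGens j (X, Y) := by
  have e1 : (sc w hw * X)⁻¹ = sc (w ^ 2) (by linear_combination (w ^ 3 + 1) * hw) * X⁻¹ := by
    rw [mul_inv_rev, sc_inv, sc_comm]
  have e2 : (sc u hu * Y)⁻¹ = sc (u ^ 2) (by linear_combination (u ^ 3 + 1) * hu) * Y⁻¹ := by
    rw [mul_inv_rev, sc_inv, sc_comm]
  have mv : ∀ (a b : ℂ) (ha : a ^ 3 = 1) (hb : b ^ 3 = 1) (A B : SL3),
      (sc a ha * A) * (sc b hb * B) = sc a ha * (sc b hb * (A * B)) := by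
    intro a b ha hb A B
    rw [mul_assoc, ← mul_assoc A, sc_comm, mul_assoc]
  fin_cases j <;> simp [nineGens, e1, e2, mv, tr3_sc_mul, mul_assoc]
  have lc : ∀ (a : ℂ) (ha : a ^ 3 = 1) (A B : SL3),
      A * (sc a ha * B) = sc a ha * (A * B) := by
    intro a ha A B
    rw [← mul_assoc, sc_comm, mul_assoc]
  rw [lc, tr3_sc_mul, lc, lc, tr3_sc_mul]
  linear_combination (u ^ 3 * hw + hu) * tr3 (X * (Y * (X⁻¹ * Y⁻¹)))

/-- Rescaling criterion. -/
theorem not_mem_of_scale (i : Fin 9) (w u : ℂ) (hw : w ^ 3 = 1) (hu : u ^ 3 = 1) (X Y : SL3)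
    (h : ∀ j, j ≠ i → nineGens j (X, Y) = 0 ∨
      (![w, u, w * u, w ^ 2, u ^ 2, w * u ^ 2, u * w ^ 2, w ^ 2 * u ^ 2, 1] : Fin 9 → ℂ) j = 1)
    (hi : nineGens i (X, Y) ≠ 0)
    (hi' : (![w, u, w * u, w ^ 2, u ^ 2, w * u ^ 2, u * w ^ 2, w ^ 2 * u ^ 2, 1] :
      Fin 9 → ℂ) i ≠ 1) :
    nineGens i ∉ Algebra.adjoin ℂ (nineGens '' {j | j ≠ i}) := by
  apply not_mem_of_points i (sc w hw * X, sc u hu * Y) (X, Y)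
  · intro j hj
    rw [gens_scale]
    rcases h j hj with h | h <;> simp [h]
  · rw [gens_scale]
    intro h
    exact hi' (mul_right_cancel₀ hi (by rw [h, one_mul]))

/-- The generating set of nine trace functions is minimal: none of them lies in
the ℂ-subalgebra generated by the other eight. -/
theorem nineGens_minimal :
    ∀ i : Fin 9, nineGens i ∉ Algebra.adjoin ℂ (nineGens '' {j | j ≠ i}) := by
  obtain ⟨r, hr⟩ := IsAlgClosed.exists_pow_nat_eq (-2 : ℂ) (n := 3) (by norm_num)
  obtain ⟨s, hs⟩ := IsAlgClosed.exists_pow_nat_eq (-3 : ℂ) (n := 2) (by norm_num)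
  obtain ⟨w, hw⟩ : ∃ w : ℂ, w ^ 2 + w + 1 = 0 := ⟨(-1 + s) / 2, by linear_combination hs / 4⟩
  have hw3 : w ^ 3 = 1 := by linear_combination (w - 1) * hw
  have hw1 : w ≠ 1 := by
    rintro rfl
    norm_num at hw
  have hw2 : w ^ 2 ≠ 1 := by
    intro h
    apply hw1
    linear_combination hw3 - w * h
  have hw4 : w ^ 4 = w := by linear_combination w * hw3
  have hw6 : (w ^ 2) ^ 3 = 1 := by linear_combination (w ^ 3 + 1) * hw3
  have hr0 : r ≠ 0 := by
    rintro rfl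
    norm_num at hr
  have hD : r * r * (-r / 2) = 1 := by linear_combination -hr / 2
  have hE : (-r ^ 2 / 2) * (-r ^ 2 / 2) * (r ^ 2) = 1 := by
    linear_combination (r ^ 3 - 2) / 4 * hr
  have hZ : 1 * w * w ^ 2 = 1 := by linear_combination hw3
  have one3 : (1 : ℂ) ^ 3 = 1 := by norm_num
  have hDi : (dg _ _ _ hD)⁻¹ = dg _ _ _ hE := by
    rw [dg_inv]; congr 1 <;> ring
  have hEi : (dg _ _ _ hE)⁻¹ = dg _ _ _ hD := by rw [← hDi, inv_inv]
  have tD : tr3 (dg _ _ _ hD) ≠ 0 := by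
    rw [tr3_dg]
    intro h
    apply hr0
    linear_combination 2 / 3 * h
  have tE : tr3 (dg _ _ _ hE) = 0 := by
    rw [tr3_dg]
    ring
  have PE := tr3_cyc_dg _ _ _ hE
  have PD := tr3_cyc_dg _ _ _ hD
  have P'E := tr3_cyc'_dg _ _ _ hE
  have P'D := tr3_cyc'_dg _ _ _ hD
  have EP := tr3_dg_cyc _ _ _ hE
  have DP := tr3_dg_cyc _ _ _ hD
  have EP' := tr3_dg_cyc' _ _ _ hE
  have DP' := tr3_dg_cyc' _ _ _ hD
  have PZ := tr3_cyc_dg _ _ _ hZ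
  have P'Z := tr3_cyc'_dg _ _ _ hZ
  have ZP := tr3_dg_cyc _ _ _ hZ
  have ZP' := tr3_dg_cyc' _ _ _ hZ
  have tP := tr3_cyc
  have tP' := tr3_cyc'
  have P1 : cyc * cyc' = 1 := by rw [← cyc_inv, mul_inv_cancel]
  have P2 : cyc' * cyc = 1 := by rw [← cyc_inv, inv_mul_cancel]
  generalize dg _ _ _ hD = D at *
  generalize dg _ _ _ hE = E at *
  have cD : tr3 (cyc * (D * cyc')) = tr3 D := by rw [tr3_comm, mul_assoc, P2, mul_one]
  have cE : tr3 (cyc * (E * cyc')) = tr3 E := by rw [tr3_comm, mul_assoc, P2, mul_one]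
  have c1 (A : SL3) : cyc * (cyc' * A) = A := by rw [← mul_assoc, P1, one_mul]
  have c2 (A : SL3) : cyc' * (cyc * A) = A := by rw [← mul_assoc, P2, one_mul]
  have e1 : w * w ^ 2 = 1 := by linear_combination hw3
  have e2 : w ^ 2 * w = 1 := by linear_combination hw3
  have e3 : w * (w ^ 2) ^ 2 ≠ 1 := by
    intro h; apply hw2; linear_combination h - w ^ 2 * hw3
  have e4 : w ^ 2 * w ^ 2 ≠ 1 := by
    intro h; apply hw1; linear_combination h - w * hw3
  have e5 : w * w ≠ 1 := by rwa [← pow_two]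
  have e6 : w ^ 2 * (w ^ 2) ^ 2 = 1 := by linear_combination (w ^ 3 + 1) * hw3
  intro i
  fin_cases i
  · apply not_mem_of_scale 0 w 1 hw3 one3 D cyc
    · intro j hj
      fin_cases j <;> simp [nineGens, mul_assoc, cyc_inv, cyc'_inv, *] at hj ⊢
    · simp [nineGens, mul_assoc, cyc_inv, cyc'_inv, *]
    · simp [*]
  · apply not_mem_of_scale 1 1 w one3 hw3 cyc D
    · intro j hj
      fin_cases j <;> simp [nineGens, mul_assoc, cyc_inv, cyc'_inv, *] at hj ⊢
    · simp [nineGens, mul_assoc, cyc_inv, cyc'_inv, *]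
    · simp [*]
  · apply not_mem_of_scale 2 w w hw3 hw3 cyc (D * cyc')
    · intro j hj
      fin_cases j <;> simp [nineGens, mul_assoc, cyc_inv, cyc'_inv, *] at hj ⊢
    · simp [nineGens, mul_assoc, cyc_inv, cyc'_inv, *]
    · simp [*]
  · apply not_mem_of_scale 3 w 1 hw3 one3 E cyc
    · intro j hj
      fin_cases j <;> simp [nineGens, mul_assoc, cyc_inv, cyc'_inv, *] at hj ⊢
    · simp [nineGens, mul_assoc, cyc_inv, cyc'_inv, *]
    · simp [*]
  · apply not_mem_of_scale 4 1 w one3 hw3 cyc E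
    · intro j hj
      fin_cases j <;> simp [nineGens, mul_assoc, cyc_inv, cyc'_inv, *] at hj ⊢
    · simp [nineGens, mul_assoc, cyc_inv, cyc'_inv, *]
    · simp [*]
  · apply not_mem_of_scale 5 w (w ^ 2) hw3 hw6 cyc (cyc * E)
    · intro j hj
      fin_cases j <;> simp [nineGens, mul_assoc, cyc_inv, cyc'_inv, *] at hj ⊢
    · simp [nineGens, mul_assoc, cyc_inv, cyc'_inv, *]
    · simp [*]
  · apply not_mem_of_scale 6 w (w ^ 2) hw3 hw6 cyc (D * cyc)
    · intro j hj
      fin_cases j <;> simp [nineGens, mul_assoc, cyc_inv, cyc'_inv, *] at hj ⊢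
    · simp [nineGens, mul_assoc, cyc_inv, cyc'_inv, *]
    · simp [*]
  · apply not_mem_of_scale 7 w w hw3 hw3 cyc (E * cyc')
    · intro j hj
      fin_cases j <;> simp [nineGens, mul_assoc, cyc_inv, cyc'_inv, *] at hj ⊢
    · simp [nineGens, mul_assoc, cyc_inv, cyc'_inv, *]
    · simp [*]
  · apply not_mem_of_points 8 (dg _ _ _ hZ, cyc) (cyc, dg _ _ _ hZ)
    · intro j hj
      fin_cases j <;>
        simp [nineGens, cyc_inv, dg_inv, tr3_dg, tr3_cyc, tr3_cyc', tr3_dg_cyc, tr3_dg_cyc',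
          tr3_cyc_dg, tr3_cyc'_dg] at hj ⊢
      · linear_combination hw
      · linear_combination -hw
      · linear_combination hw + hw3
      · linear_combination -hw - hw3
    · have h1 : tr3 (dg _ _ _ hZ * cyc * (dg _ _ _ hZ)⁻¹ * cyc⁻¹) = 3 * w ^ 2 := by
        rw [dg_inv, mul_assoc (dg _ _ _ _), cyc_mul_dg, ← mul_assoc, mul_inv_cancel_right,
          dg_mul_dg, tr3_dg]
        linear_combination w ^ 2 * hw3
      have h2 : tr3 (cyc * dg _ _ _ hZ * cyc⁻¹ * (dg _ _ _ hZ)⁻¹) = 3 * w := by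
        rw [dg_inv, cyc_mul_dg, mul_inv_cancel_right, dg_mul_dg, tr3_dg]
        linear_combination 2 * w * hw3
      change tr3 (dg _ _ _ hZ * cyc * (dg _ _ _ hZ)⁻¹ * cyc⁻¹) ≠
        tr3 (cyc * dg _ _ _ hZ * cyc⁻¹ * (dg _ _ _ hZ)⁻¹)
      rw [h1, h2]
      intro h
      apply hw1
      linear_combination (w ^ 2 / 3) * h - (w - 1) * hw3
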